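/- arXiv:1306.3549 — 2 statements merged into one kernel-verified Lean document; each statement's English description precedes it below -/
import Mathlib

section
/- Let m ≥ 1 be an integer, let p, k ∈ ℝ, let f : ℝ^m ∖ {0} → ℝ be f(x) = |x|^k, and for 1 ≤ i ≤ m let u_i(x) = x_i·|x|^{−p} (the components of the map φ(x) = x/|x|^p). Then Δ(f·Δu_i) = 0 identically on ℝ^m ∖ {0} for every i (i.e. φ is f-biharmonic for f(x) = |x|^k) if and only if p(p − m)(k − p − 2)(k − p + m − 2) = 0, that is, if and only if (i) p = 0, or (ii) p = m, or (iii) k = p + 2, or (iv) k = p + 2 − m. -/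
/-- The Euclidean Laplacian `Δu = ∑ i ∂²u/∂x_i²` of a function on `ℝ^m`. -/
noncomputable def eLaplacian {m : ℕ} (u : EuclideanSpace ℝ (Fin m) → ℝ)
    (x : EuclideanSpace ℝ (Fin m)) : ℝ :=
  ∑ i : Fin m,
    fderiv ℝ (fun y => fderiv ℝ u y (EuclideanSpace.single i 1)) x (EuclideanSpace.single i 1)

/-- The Fréchet derivative of `‖·‖ ^ a` away from the origin. -/
theorem hasFDerivAt_norm_rpow_of_ne_zero {E : Type*} [NormedAddCommGroup E]
    [InnerProductSpace ℝ E] (a : ℝ) {x : E} (hx : x ≠ 0) :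
    HasFDerivAt (fun y : E => ‖y‖ ^ a) ((a * ‖x‖ ^ (a - 2)) • innerSL ℝ x) x := by
  have hpos : 0 < ‖x‖ := norm_pos_iff.mpr hx
  have h := ((hasStrictFDerivAt_norm_sq x).hasFDerivAt).rpow_const (p := a / 2)
    (Or.inl (by positivity))
  have hpow : ∀ (y : E) (b : ℝ), (‖y‖ ^ 2) ^ b = ‖y‖ ^ (2 * b) := fun y b => by
    rw [← Real.rpow_natCast, ← Real.rpow_mul (norm_nonneg y)]
    norm_num
  simp only [hpow] at h
  refine (h.congr_fderiv ?_).congr_of_eventuallyEq (.of_forall fun y => ?_)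
  · ext v
    simp only [smul_apply, smul_eq_mul, nsmul_eq_mul, Nat.cast_ofNat]
    rw [show 2 * (a / 2 - 1) = a - 2 by ring]
    simp
    ring
  · simp only
    congr 1
    ring

theorem hasFDerivAt_euclidean_apply {m : ℕ} (i : Fin m) (x : EuclideanSpace ℝ (Fin m)) :
    HasFDerivAt (fun y : EuclideanSpace ℝ (Fin m) => y i)
      (EuclideanSpace.proj i : EuclideanSpace ℝ (Fin m) →L[ℝ] ℝ) x :=
  (EuclideanSpace.proj i : EuclideanSpace ℝ (Fin m) →L[ℝ] ℝ).hasFDerivAt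

theorem fderiv_apply_mul_norm_rpow {m : ℕ} (c a : ℝ) (i j : Fin m)
    {x : EuclideanSpace ℝ (Fin m)} (hx : x ≠ 0) :
    fderiv ℝ (fun y : EuclideanSpace ℝ (Fin m) => c * (y i * ‖y‖ ^ a)) x
        (EuclideanSpace.single j 1) =
      c * ((if i = j then 1 else 0) * ‖x‖ ^ a + a * (x i * (x j * ‖x‖ ^ (a - 2)))) := by
  have hd := ((hasFDerivAt_euclidean_apply i x).mul
    (hasFDerivAt_norm_rpow_of_ne_zero a hx)).const_mul c
  refine (congrArg (fun L => L (EuclideanSpace.single j 1)) hd.fderiv).trans ?_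
  by_cases hij : i = j <;> 
    simp [EuclideanSpace.inner_single_right, hij, -mul_eq_mul_left_iff] <;> ring

/-- `Δ (x_i |x|^a) = a (a + m) x_i |x|^(a - 2)` away from the origin. -/
theorem eLaplacian_apply_mul_norm_rpow {m : ℕ} (c a : ℝ) (i : Fin m)
    {x : EuclideanSpace ℝ (Fin m)} (hx : x ≠ 0) :
    eLaplacian (fun y : EuclideanSpace ℝ (Fin m) => c * (y i * ‖y‖ ^ a)) x =
      c * (a * (a + m)) * (x i * ‖x‖ ^ (a - 2)) := by
  have hpos : 0 < ‖x‖ := norm_pos_iff.mpr hx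
  have key : ∀ j : Fin m,
      fderiv ℝ (fun y => fderiv ℝ (fun y : EuclideanSpace ℝ (Fin m) => c * (y i * ‖y‖ ^ a)) y
        (EuclideanSpace.single j 1)) x (EuclideanSpace.single j 1) =
      (if i = j then 2 * c * a * x j * ‖x‖ ^ (a - 2) else 0) + c * a * x i * ‖x‖ ^ (a - 2) +
        c * a * (a - 2) * x i * ‖x‖ ^ (a - 4) * x j ^ 2 := fun j => by
    have hev : (fun y => fderiv ℝ (fun y : EuclideanSpace ℝ (Fin m) => c * (y i * ‖y‖ ^ a)) y
        (EuclideanSpace.single j 1)) =ᶠ[nhds x] fun y =>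
        c * ((if i = j then 1 else 0) * ‖y‖ ^ a + a * (y i * (y j * ‖y‖ ^ (a - 2)))) := by
      filter_upwards [isOpen_ne.mem_nhds hx] with y hy
      exact fderiv_apply_mul_norm_rpow c a i j hy
    have hi := hasFDerivAt_euclidean_apply i x
    have hj := hasFDerivAt_euclidean_apply j x
    have hd := (((hasFDerivAt_norm_rpow_of_ne_zero a hx).const_mul
      (if i = j then (1 : ℝ) else 0)).add ((hi.mul (hj.mul
        (hasFDerivAt_norm_rpow_of_ne_zero (a - 2) hx))).const_mul a)).const_mul c
    rw [hev.fderiv_eq]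
    refine (congrArg (fun L => L (EuclideanSpace.single j 1)) hd.fderiv).trans ?_
    rw [show a - 2 - 2 = a - 4 by ring]
    by_cases hij : i = j
    · subst hij
      simp [EuclideanSpace.inner_single_right]
      ring
    · simp [EuclideanSpace.inner_single_right, hij]
      ring
  have hsum : ∑ j : Fin m, x j ^ 2 = ‖x‖ ^ 2 := (EuclideanSpace.real_norm_sq_eq x).symm
  have hpow : ‖x‖ ^ (a - 4) * ‖x‖ ^ 2 = ‖x‖ ^ (a - 2) := by
    rw [← Real.rpow_natCast, ← Real.rpow_add hpos]
    congr 1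
    push_cast
    ring
  unfold eLaplacian
  simp only [key, Finset.sum_add_distrib, ← Finset.mul_sum, hsum, Finset.sum_ite_eq,
    Finset.mem_univ, if_true, Finset.sum_const, Finset.card_univ, Fintype.card_fin, nsmul_eq_mul]
  linear_combination c * a * (a - 2) * x i * hpow

theorem eLaplacian_congr_of_eventuallyEq {m : ℕ} {u v : EuclideanSpace ℝ (Fin m) → ℝ}
    {x : EuclideanSpace ℝ (Fin m)} (h : u =ᶠ[nhds x] v) : eLaplacian u x = eLaplacian v x := by
  refine Finset.sum_congr rfl fun i _ => ?_
  have : (fun y => fderiv ℝ u y (EuclideanSpace.single i 1)) =ᶠ[nhds x]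
      fun y => fderiv ℝ v y (EuclideanSpace.single i 1) :=
    (h.fderiv (𝕜 := ℝ)).mono fun y hy => congrArg (fun L => L (EuclideanSpace.single i 1)) hy
  rw [this.fderiv_eq]

/-- The `f`-bi-Laplacian of `x_i |x|^(-p)` for `f = |x|^k`. -/
theorem eLaplacian_norm_rpow_mul_eLaplacian {m : ℕ} (p k : ℝ) (i : Fin m)
    {x : EuclideanSpace ℝ (Fin m)} (hx : x ≠ 0) :
    eLaplacian (fun y => ‖y‖ ^ k * eLaplacian (fun z => z i * ‖z‖ ^ (-p)) y) x =
      p * (p - m) * (k - p - 2) * (k - p + m - 2) * (x i * ‖x‖ ^ (k - p - 4)) := by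
  have hev : (fun y => ‖y‖ ^ k * eLaplacian (fun z => z i * ‖z‖ ^ (-p)) y) =ᶠ[nhds x]
      fun y => (p * (p - m)) * (y i * ‖y‖ ^ (k - p - 2)) := by
    filter_upwards [isOpen_ne.mem_nhds hx] with y hy
    have h := eLaplacian_apply_mul_norm_rpow 1 (-p) i hy
    simp only [one_mul] at h
    have hpow : ‖y‖ ^ k * ‖y‖ ^ (-p - 2) = ‖y‖ ^ (k - p - 2) := by
      rw [← Real.rpow_add (norm_pos_iff.mpr hy)]
      congr 1
      ring
    rw [h]
    linear_combination p * (p - m) * y i * hpow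
  rw [eLaplacian_congr_of_eventuallyEq hev, eLaplacian_apply_mul_norm_rpow _ _ i hx,
    show k - p - 2 - 2 = k - p - 4 by ring]
  ring

/-- The map `φ(x) = x/|x|^p`, with components `u_i(x) = x_i·|x|^{−p}`, is `f`-biharmonic on
`ℝ^m ∖ {0}` for `f(x) = |x|^k` (i.e. `Δ(f·Δu_i) = 0` for every `i`) if and only if
`p(p − m)(k − p − 2)(k − p + m − 2) = 0`, i.e. iff `p = 0`, `p = m`, `k = p + 2`,
or `k = p + 2 − m`. -/
theorem stmt_8 (m : ℕ) (hm : 1 ≤ m) (p k : ℝ)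
    (f : EuclideanSpace ℝ (Fin m) → ℝ) (hf : f = fun x => ‖x‖ ^ k)
    (u : Fin m → EuclideanSpace ℝ (Fin m) → ℝ)
    (hu : ∀ i : Fin m, u i = fun x => x i * ‖x‖ ^ (-p)) :
    ((∀ i : Fin m, ∀ x : EuclideanSpace ℝ (Fin m), x ≠ 0 →
        eLaplacian (fun y => f y * eLaplacian (u i) y) x = 0)
      ↔ p * (p - (m : ℝ)) * (k - p - 2) * (k - p + (m : ℝ) - 2) = 0) ∧
    (p * (p - (m : ℝ)) * (k - p - 2) * (k - p + (m : ℝ) - 2) = 0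
      ↔ (p = 0 ∨ p = (m : ℝ) ∨ k = p + 2 ∨ k = p + 2 - (m : ℝ))) := by
  subst hf
  obtain rfl : u = fun i x => x i * ‖x‖ ^ (-p) := funext hu
  refine ⟨⟨fun h => ?_, fun h i x hx => ?_⟩, ?_⟩
  · let i : Fin m := ⟨0, hm⟩
    have hx : EuclideanSpace.single i (1 : ℝ) ≠ 0 := by simp
    have h1 := h i _ hx
    rw [eLaplacian_norm_rpow_mul_eLaplacian p k i hx] at h1
    simpa using h1
  · rw [eLaplacian_norm_rpow_mul_eLaplacian p k i hx, h, zero_mul]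
  · simp only [mul_eq_zero, or_assoc]
    refine or_congr Iff.rfl (or_congr sub_eq_zero (or_congr ?_ ?_)) <;>
      constructor <;> intro h <;> linarith
end

section
/- Let c ∈ ℝ, let a < b, and let κ : (a, b) → ℝ be a twice continuously differentiable function with κ(s) > 0 for all s ∈ (a, b). Then κ satisfies the ordinary differential equation 3(κ'(s))² − 2κ(s)·κ''(s) = 4(1 + c²)·(κ(s))⁴ for all s ∈ (a, b) if and only if there exist constants c₂ > 0 and c₃ ∈ ℝ such that κ(s) = 4c₂/(16(1 + c²) + (c₂·s + c₃)²) for all s ∈ (a, b). -/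
/-- A function with zero derivative on an open interval is constant there. -/
theorem exists_eq_const_of_hasDerivAt_zero {a b : ℝ} {f : ℝ → ℝ}
    (hf : ∀ s ∈ Set.Ioo a b, HasDerivAt f 0 s) :
    ∃ C, ∀ s ∈ Set.Ioo a b, f s = C :=
  isOpen_Ioo.exists_is_const_of_deriv_eq_zero isPreconnected_Ioo
    (fun s hs => (hf s hs).differentiableAt.differentiableWithinAt)
    (fun s hs => (hf s hs).deriv)

/-- First integrals of `3κ'² − 2κκ'' = 4Aκ⁴` determine its positive solutions. -/
theorem exists_eq_of_three_mul_sq_sub {A a b : ℝ} (hA : 0 < A) (hab : a < b)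
    {κ p q : ℝ → ℝ} (hκ : ∀ s ∈ Set.Ioo a b, HasDerivAt κ (p s) s)
    (hp : ∀ s ∈ Set.Ioo a b, HasDerivAt p (q s) s)
    (hpos : ∀ s ∈ Set.Ioo a b, 0 < κ s)
    (h : ∀ s ∈ Set.Ioo a b, 3 * p s ^ 2 - 2 * κ s * q s = 4 * A * κ s ^ 4) :
    ∃ c₂ : ℝ, 0 < c₂ ∧ ∃ c₃ : ℝ, ∀ s ∈ Set.Ioo a b,
      κ s = 4 * c₂ / (16 * A + (c₂ * s + c₃) ^ 2) := by
  obtain ⟨c₂, hc₂⟩ := exists_eq_const_of_hasDerivAt_zero (a := a) (b := b)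
    (f := fun s => 4 * A * κ s + p s ^ 2 / κ s ^ 3) fun s hs => by
      have hne := (hpos s hs).ne'
      refine (((hκ s hs).const_mul (4 * A)).add
        (((hp s hs).pow 2).div ((hκ s hs).pow 3) (pow_ne_zero 3 hne))).congr_deriv ?_
      simp only [Pi.pow_apply]
      field_simp
      push_cast
      linear_combination -(κ s ^ 2 * p s) * h s hs
  obtain ⟨c₃, hc₃⟩ := exists_eq_const_of_hasDerivAt_zero (a := a) (b := b)
    (f := fun s => -2 * p s / κ s ^ 2 - c₂ * s) fun s hs => by
      have hne := (hpos s hs).ne'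
      refine ((((hp s hs).const_mul (-2)).div ((hκ s hs).pow 2) (pow_ne_zero 2 hne)).sub
        ((hasDerivAt_id s).const_mul c₂)).congr_deriv ?_
      rw [← hc₂ s hs]
      simp only [Pi.pow_apply]
      field_simp
      push_cast
      linear_combination κ s * h s hs
  obtain ⟨m, hm⟩ := Set.nonempty_Ioo.mpr hab
  refine ⟨c₂, ?_, c₃, fun s hs => ?_⟩
  · have := hpos m hm
    rw [← hc₂ m hm]
    positivity
  · have hs0 := hpos s hs
    have hD : 0 < 16 * A + (c₂ * s + c₃) ^ 2 := by positivity
    rw [eq_div_iff hD.ne', ← hc₃ s hs, add_sub_cancel, ← hc₂ s hs]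
    field_simp
    ring

/-- The functions `4c₂/(16A + (c₂s + c₃)²)` solve `3κ'² − 2κκ'' = 4Aκ⁴`. -/
theorem three_mul_sq_deriv_sub_eq {A : ℝ} (hA : 0 < A) (c₂ c₃ s : ℝ) {g : ℝ → ℝ}
    (hg : g = fun s => 4 * c₂ / (16 * A + (c₂ * s + c₃) ^ 2)) :
    3 * (deriv g s) ^ 2 - 2 * g s * deriv (deriv g) s = 4 * A * g s ^ 4 := by
  have hD : ∀ s, 16 * A + (c₂ * s + c₃) ^ 2 ≠ 0 := fun s => by positivity
  have hl : ∀ s, HasDerivAt (fun s => c₂ * s + c₃) c₂ s := fun s => by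
    simpa using ((hasDerivAt_id s).const_mul c₂).add_const c₃
  have hd : ∀ s, HasDerivAt (fun s => 16 * A + (c₂ * s + c₃) ^ 2)
      (2 * (c₂ * s + c₃) * c₂) s := fun s => by
    simpa using ((hl s).pow 2).const_add (16 * A)
  have hg' : deriv g =
      fun s => -8 * c₂ ^ 2 * (c₂ * s + c₃) / (16 * A + (c₂ * s + c₃) ^ 2) ^ 2 := by
    funext s
    rw [hg, ((hasDerivAt_const s (4 * c₂)).fun_div (hd s) (hD s)).deriv]
    ring
  have hg'' := (((hl s).const_mul (-8 * c₂ ^ 2)).fun_div ((hd s).fun_pow 2)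
    (pow_ne_zero 2 (hD s))).deriv
  have hDs := hD s
  rw [hg', hg'', hg]
  field_simp
  push_cast
  ring

/-- A positive `C²` function `κ` on `(a, b)` satisfies `3κ'² − 2κκ'' = 4(1 + c²)κ⁴` if and
only if `κ(s) = 4c₂/(16(1 + c²) + (c₂s + c₃)²)` for some constants `c₂ > 0` and `c₃`. -/
theorem stmt_12 (c a b : ℝ) (hab : a < b) (κ : ℝ → ℝ)
    (hκ : ContDiffOn ℝ 2 κ (Set.Ioo a b)) (hκpos : ∀ s ∈ Set.Ioo a b, 0 < κ s) :
    (∀ s ∈ Set.Ioo a b,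
        3 * (deriv κ s) ^ 2 - 2 * κ s * deriv (deriv κ) s
          = 4 * (1 + c ^ 2) * (κ s) ^ 4)
      ↔ ∃ c₂ : ℝ, 0 < c₂ ∧ ∃ c₃ : ℝ, ∀ s ∈ Set.Ioo a b,
          κ s = 4 * c₂ / (16 * (1 + c ^ 2) + (c₂ * s + c₃) ^ 2) := by
  have hA : 0 < 1 + c ^ 2 := by positivity
  constructor
  · refine exists_eq_of_three_mul_sq_sub hA hab (fun s hs => ?_) (fun s hs => ?_) hκpos
    · exact ((hκ.differentiableOn two_ne_zero).differentiableAt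
        (isOpen_Ioo.mem_nhds hs)).hasDerivAt
    · have h1 : ContDiffOn ℝ 1 (deriv κ) (Set.Ioo a b) :=
        hκ.deriv_of_isOpen isOpen_Ioo (by norm_num)
      exact ((h1.differentiableOn one_ne_zero).differentiableAt
        (isOpen_Ioo.mem_nhds hs)).hasDerivAt
  · rintro ⟨c₂, -, c₃, h⟩ s hs
    have he : κ =ᶠ[nhds s] fun s => 4 * c₂ / (16 * (1 + c ^ 2) + (c₂ * s + c₃) ^ 2) :=
      Filter.eventuallyEq_of_mem (isOpen_Ioo.mem_nhds hs) h
    rw [he.deriv.deriv_eq, he.deriv_eq, he.eq_of_nhds]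
    exact three_mul_sq_deriv_sub_eq hA c₂ c₃ s rfl
end
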